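/- Let u : ℝ² → ℝ² be twice continuously differentiable with bounded second derivatives. Then for every x ∈ ℝ², lim_{δ→0⁺} (6/δ³) ∫_{{y : 0 < |y−x|₂ ≤ δ}} ((x−y)(x−y)ᵀ/|x−y|₂³)(u(x) − u(y)) dy = −(π/4) Δu(x) − (π/2) ∇(div u)(x), where Δ acts componentwise; i.e., the scaled linear bond-based peridynamic operator converges pointwise to the local Navier operator as the horizon δ vanishes. -/

import Mathlib

open MeasureTheory Filter

noncomputable section

abbrev E2 := EuclideanSpace ℝ (Fin 2)

/-- Componentwise Laplacian of a vector field on `ℝ²`. -/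
def vecLaplacian (u : E2 → E2) (x : E2) : E2 :=
  ∑ i : Fin 2,
    fderiv ℝ (fun z => fderiv ℝ u z (EuclideanSpace.single i 1)) x (EuclideanSpace.single i 1)

/-- Divergence of a vector field on `ℝ²`. -/
def diverg (u : E2 → E2) (x : E2) : ℝ :=
  ∑ i : Fin 2, fderiv ℝ u x (EuclideanSpace.single i 1) i

/-- Gradient of the divergence of a vector field on `ℝ²`. -/
def gradDiv (u : E2 → E2) (x : E2) : E2 :=
  (WithLp.equiv 2 (Fin 2 → ℝ)).symm
    (fun i => fderiv ℝ (diverg u) x (EuclideanSpace.single i 1))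

end

open scoped RealInnerProductSpace

theorem norm_taylor_one_remainder_le {u : E2 → E2} (hu : ContDiff ℝ 2 u) {M : ℝ}
    (hM : ∀ x, ‖iteratedFDeriv ℝ 2 u x‖ ≤ M) (x v : E2) :
    ‖u (x + v) - u x - fderiv ℝ u x v‖ ≤ M * ‖v‖ ^ 2 := by
  have hM0 : 0 ≤ M := (norm_nonneg _).trans (hM x)
  have hdu : Differentiable ℝ (fderiv ℝ u) :=
    (hu.fderiv_right (m := 1) (by norm_num)).differentiable (by norm_num)
  have hbound : ∀ y, ‖fderiv ℝ (fderiv ℝ u) y‖ ≤ M := by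
    intro y
    have h1 := norm_iteratedFDeriv_fderiv (𝕜 := ℝ) (f := u) (x := y) (n := 1)
    have h2 := norm_iteratedFDeriv_fderiv (𝕜 := ℝ) (f := fderiv ℝ u) (x := y) (n := 0)
    rw [norm_iteratedFDeriv_zero] at h2
    rw [h2, h1]
    exact hM y
  have key := (convex_closedBall x ‖v‖).norm_image_sub_le_of_norm_fderiv_le' (𝕜 := ℝ) (f := u)
    (φ := fderiv ℝ u x) (C := M * ‖v‖) (x := x) (y := x + v)
    (fun y _ => (hu.differentiable (by norm_num)) y)
    (fun y hy => by
      refine (convex_univ.norm_image_sub_le_of_norm_fderiv_le (𝕜 := ℝ)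
        (fun z _ => hdu z) (fun z _ => hbound z) (Set.mem_univ x) (Set.mem_univ y)).trans ?_
      gcongr
      simpa [dist_eq_norm] using hy)
    (by simp) (by simp [dist_eq_norm])
  simpa [pow_two, mul_assoc] using key

theorem tendsto_taylor_two {u : E2 → E2} (hu : ContDiff ℝ 2 u) (x w : E2) :
    Tendsto (fun δ : ℝ => (δ ^ 2)⁻¹ • (u (x + δ • w) - u x - δ • fderiv ℝ u x w))
      (nhdsWithin 0 (Set.Ioi 0))
      (nhds ((1 / 2 : ℝ) • fderiv ℝ (fderiv ℝ u) x w w)) := by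
  have hdu : Differentiable ℝ (fderiv ℝ u) :=
    (hu.fderiv_right (m := 1) (by norm_num)).differentiable (by norm_num)
  have h := (convex_univ (𝕜 := ℝ) (E := E2)).taylor_approx_two_segment (f := u)
    (f' := fderiv ℝ u) (x := x) (f'' := fderiv ℝ (fderiv ℝ u) x) (v := 0) (w := w)
    (fun y _ => (hu.differentiable (by norm_num) y).hasFDerivAt) (Set.mem_univ x)
    (hdu x).hasFDerivAt.hasFDerivWithinAt (by simp) (by simp)
  have h2 := h.tendsto_inv_smul_nhds_zero.add_const ((1 / 2 : ℝ) • fderiv ℝ (fderiv ℝ u) x w w)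
  rw [zero_add] at h2
  refine h2.congr' ?_
  filter_upwards [self_mem_nhdsWithin] with δ hδ
  have hδ' : δ ≠ 0 := ne_of_gt hδ
  simp only [smul_zero, add_zero, map_zero, zero_apply, sub_zero]
  rw [smul_sub _ _ ((δ ^ 2 / 2) • _), smul_smul]
  rw [show (δ ^ 2)⁻¹ * (δ ^ 2 / 2) = 1 / 2 by field_simp]
  abel

theorem measurableSet_punctured_ball : MeasurableSet {w : E2 | 0 < ‖w‖ ∧ ‖w‖ ≤ 1} :=
  (measurableSet_lt measurable_const measurable_norm).inter
    (measurableSet_le measurable_norm measurable_const)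

theorem integral_punctured_ball_moment (a b : ℕ) (hab : a + b = 4) :
    ∫ w in {w : E2 | 0 < ‖w‖ ∧ ‖w‖ ≤ 1}, w 0 ^ a * w 1 ^ b / ‖w‖ ^ 3
      = (1 / 3) * ∫ θ in (-Real.pi)..Real.pi, Real.cos θ ^ a * Real.sin θ ^ b := by
  rw [← integral_indicator measurableSet_punctured_ball,
    ← Complex.orthonormalBasisOneI.measurePreserving_repr.integral_comp
      Complex.orthonormalBasisOneI.repr.toHomeomorph.measurableEmbedding,
    ← Complex.integral_comp_polarCoord_symm]
  have hcongr : ∀ p ∈ polarCoord.target,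
      p.1 • Set.indicator {w : E2 | 0 < ‖w‖ ∧ ‖w‖ ≤ 1} (fun w => w 0 ^ a * w 1 ^ b / ‖w‖ ^ 3)
        (Complex.orthonormalBasisOneI.repr (Complex.polarCoord.symm p))
      = (Set.Ioc (0 : ℝ) 1).indicator (fun r => r ^ 2) p.1
        * (Real.cos p.2 ^ a * Real.sin p.2 ^ b) := by
    rintro ⟨r, θ⟩ hp
    have hr : 0 < r := by
      rw [polarCoord_target] at hp
      exact hp.1
    have hn : ‖Complex.orthonormalBasisOneI.repr (Complex.polarCoord.symm (r, θ))‖ = r := by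
      rw [LinearIsometryEquiv.norm_map, Complex.norm_polarCoord_symm, abs_of_pos hr]
    have h0 : Complex.orthonormalBasisOneI.repr (Complex.polarCoord.symm (r, θ)) 0
        = r * Real.cos θ := by
      rw [Complex.orthonormalBasisOneI_repr_apply]
      simp [Complex.polarCoord_symm_apply, Complex.cos_ofReal_re]
    have h1 : Complex.orthonormalBasisOneI.repr (Complex.polarCoord.symm (r, θ)) 1
        = r * Real.sin θ := by
      rw [Complex.orthonormalBasisOneI_repr_apply]
      simp [Complex.polarCoord_symm_apply, Complex.sin_ofReal_re]
    by_cases hr1 : r ≤ 1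
    · rw [Set.indicator_of_mem (by rw [Set.mem_ofPred_eq, hn]; exact ⟨hr, hr1⟩),
        Set.indicator_of_mem (Set.mem_Ioc.2 ⟨hr, hr1⟩), h0, h1, hn, mul_pow, mul_pow, smul_eq_mul]
      have : r ^ a * r ^ b = r ^ 4 := by rw [← pow_add, hab]
      field_simp
      linear_combination (Real.cos θ ^ a * Real.sin θ ^ b) * this
    · rw [Set.indicator_of_notMem (by rw [Set.mem_ofPred_eq, hn]; exact fun h => hr1 h.2),
        Set.indicator_of_notMem (by simp [hr1])]
      simp
  rw [setIntegral_congr_fun polarCoord.open_target.measurableSet hcongr,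
    polarCoord_target, Measure.volume_eq_prod,
    setIntegral_prod_mul (fun r => (Set.Ioc (0 : ℝ) 1).indicator (fun r => r ^ 2) r)
      (fun θ => Real.cos θ ^ a * Real.sin θ ^ b),
    setIntegral_indicator measurableSet_Ioc,
    Set.inter_eq_self_of_subset_right Set.Ioc_subset_Ioi_self,
    ← intervalIntegral.integral_of_le zero_le_one, integral_pow,
    intervalIntegral.integral_of_le (by linarith [Real.pi_pos]), integral_Ioc_eq_integral_Ioo]
  norm_num

theorem integral_cos_four : ∫ θ in (-Real.pi)..Real.pi, Real.cos θ ^ 4 * Real.sin θ ^ 0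
    = 3 * Real.pi / 4 := by
  simp only [pow_zero, mul_one]
  rw [integral_cos_pow, integral_cos_sq]
  simp
  ring

theorem integral_sin_four : ∫ θ in (-Real.pi)..Real.pi, Real.cos θ ^ 0 * Real.sin θ ^ 4
    = 3 * Real.pi / 4 := by
  simp only [pow_zero, one_mul]
  rw [integral_sin_pow, integral_sin_sq]
  simp
  ring

theorem integral_cos_two_sin_two :
    ∫ θ in (-Real.pi)..Real.pi, Real.cos θ ^ 2 * Real.sin θ ^ 2 = Real.pi / 4 := by
  simp only [mul_comm (Real.cos _ ^ 2)]
  rw [integral_sin_sq_mul_cos_sq]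
  have h1 : Real.sin (4 * Real.pi) = 0 := by exact_mod_cast Real.sin_nat_mul_pi 4
  simp [h1]
  ring

theorem integral_cos_three_sin :
    ∫ θ in (-Real.pi)..Real.pi, Real.cos θ ^ 3 * Real.sin θ ^ 1 = 0 := by
  simp only [mul_comm (Real.cos _ ^ 3)]
  have := integral_sin_pow_odd_mul_cos_pow (a := -Real.pi) (b := Real.pi) 0 3
  simpa using this

theorem integral_cos_sin_three :
    ∫ θ in (-Real.pi)..Real.pi, Real.cos θ ^ 1 * Real.sin θ ^ 3 = 0 := by
  simp only [mul_comm (Real.cos _ ^ 1)]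
  have := integral_sin_pow_mul_cos_pow_odd (a := -Real.pi) (b := Real.pi) 3 0
  simpa using this

theorem norm_smul_taylor_remainder_le {u : E2 → E2} (hu : ContDiff ℝ 2 u) {M : ℝ}
    (hM : ∀ x, ‖iteratedFDeriv ℝ 2 u x‖ ≤ M) (x w : E2) {δ : ℝ} (hδ : 0 < δ) :
    ‖(δ ^ 2)⁻¹ • (u (x + δ • w) - u x - δ • fderiv ℝ u x w)‖ ≤ M * ‖w‖ ^ 2 := by
  have h := norm_taylor_one_remainder_le hu hM x (δ • w)
  rw [map_smul, norm_smul, Real.norm_of_nonneg hδ.le] at h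
  rw [norm_smul, norm_inv, norm_pow, Real.norm_of_nonneg hδ.le, inv_mul_le_iff₀ (by positivity)]
  linarith [h]

/-- The micromodulus matrix `w wᵀ / |w|³` of a bond `w`, applied to a relative displacement `v`. -/
noncomputable def bondForce (w v : E2) : E2 := (⟪w, v⟫ / ‖w‖ ^ 3) • w

theorem bondForce_add (w v v' : E2) : bondForce w (v + v') = bondForce w v + bondForce w v' := by
  simp only [bondForce, inner_add_right, add_div, add_smul]

theorem bondForce_smul (c : ℝ) (w v : E2) : bondForce w (c • v) = c • bondForce w v := by
  simp only [bondForce, inner_smul_right, mul_div_assoc, mul_smul]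

theorem bondForce_neg (w v : E2) : bondForce w (-v) = -bondForce w v := by
  simp only [bondForce, inner_neg_right, neg_div, neg_smul]

theorem bondForce_smul_left {c : ℝ} (hc : 0 < c) (w v : E2) :
    bondForce (c • w) v = c⁻¹ • bondForce w v := by
  simp only [bondForce, norm_smul, real_inner_smul_left, smul_smul, Real.norm_eq_abs, abs_of_pos hc]
  congr 1
  by_cases hw : ‖w‖ = 0
  · simp [hw]
  · field_simp

theorem norm_bondForce_le (w v : E2) : ‖bondForce w v‖ ≤ ‖v‖ / ‖w‖ := by
  by_cases hw : ‖w‖ = 0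
  · simp [bondForce, norm_eq_zero.1 hw]
  have hw' : 0 < ‖w‖ := lt_of_le_of_ne (norm_nonneg w) (Ne.symm hw)
  rw [bondForce, norm_smul, norm_div, norm_pow, norm_norm]
  calc ‖⟪w, v⟫‖ / ‖w‖ ^ 3 * ‖w‖ ≤ (‖w‖ * ‖v‖) / ‖w‖ ^ 3 * ‖w‖ := by
        gcongr
        exact norm_inner_le_norm w v
    _ = ‖v‖ / ‖w‖ := by field_simp

theorem measurable_bondForce {g : E2 → E2} (hg : Measurable g) :
    Measurable fun w => bondForce w (g w) :=
  ((measurable_id.inner hg).div (measurable_norm.pow_const 3)).smul measurable_id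

theorem norm_bondForce_le_of_le {w v : E2} {C : ℝ} (hC : 0 ≤ C) (hv : ‖v‖ ≤ C * ‖w‖) :
    ‖bondForce w v‖ ≤ C :=
  (norm_bondForce_le w v).trans (div_le_of_le_mul₀ (norm_nonneg w) hC hv)

theorem volume_punctured_ball_lt_top : volume {w : E2 | 0 < ‖w‖ ∧ ‖w‖ ≤ 1} < ⊤ :=
  (measure_mono fun w hw => by simpa using hw.2).trans_lt
    (measure_closedBall_lt_top (x := (0 : E2)) (r := 1))

theorem integrableOn_bondForce {g : E2 → E2} (hg : Measurable g) {C : ℝ} (hC : 0 ≤ C)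
    (hbd : ∀ w, ‖w‖ ≤ 1 → ‖g w‖ ≤ C * ‖w‖) :
    IntegrableOn (fun w => bondForce w (g w)) {w : E2 | 0 < ‖w‖ ∧ ‖w‖ ≤ 1} :=
  Measure.integrableOn_of_bounded volume_punctured_ball_lt_top.ne
    (measurable_bondForce hg).aestronglyMeasurable
    ((ae_restrict_iff' measurableSet_punctured_ball).2
      (Eventually.of_forall fun w hw => norm_bondForce_le_of_le hC (hbd w hw.2)))

theorem integral_bondForce_linear (A : E2 →L[ℝ] E2) :
    ∫ w in {w : E2 | 0 < ‖w‖ ∧ ‖w‖ ≤ 1}, bondForce w (A w) = 0 := by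
  rw [← integral_indicator measurableSet_punctured_ball]
  have h : ∀ w, Set.indicator {w : E2 | 0 < ‖w‖ ∧ ‖w‖ ≤ 1} (fun w => bondForce w (A w)) (-w)
      = -Set.indicator {w : E2 | 0 < ‖w‖ ∧ ‖w‖ ≤ 1} (fun w => bondForce w (A w)) w := by
    intro w
    by_cases hw : 0 < ‖w‖ ∧ ‖w‖ ≤ 1
    · rw [Set.indicator_of_mem (by simpa only [Set.mem_ofPred_eq, norm_neg] using hw),
        Set.indicator_of_mem (by exact hw)]
      simp [bondForce]
    · rw [Set.indicator_of_notMem (by simpa only [Set.mem_ofPred_eq, norm_neg] using hw),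
        Set.indicator_of_notMem (by exact hw), neg_zero]
  have h2 := integral_neg_eq_self
    (Set.indicator {w : E2 | 0 < ‖w‖ ∧ ‖w‖ ≤ 1} (fun w => bondForce w (A w))) volume
  simp only [h, integral_neg] at h2
  rw [neg_eq_iff_add_eq_zero, ← two_smul ℝ] at h2
  exact (smul_eq_zero.1 h2).resolve_left two_ne_zero

theorem peridynamic_rescale (u : E2 → E2) (x : E2) {δ : ℝ} (hδ : 0 < δ) :
    (6 / δ ^ 3) • ∫ y in {y : E2 | 0 < dist y x ∧ dist y x ≤ δ},
        ((⟪x - y, u x - u y⟫ / dist x y ^ 3) • (x - y) : E2)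
      = (6 : ℝ) • ∫ w in {w : E2 | 0 < ‖w‖ ∧ ‖w‖ ≤ 1},
        bondForce w ((δ ^ 2)⁻¹ • (u x - u (x + δ • w))) := by
  have hS : MeasurableSet {y : E2 | 0 < dist y x ∧ dist y x ≤ δ} :=
    (measurableSet_lt measurable_const (measurable_id.dist measurable_const)).inter
      (measurableSet_le (measurable_id.dist measurable_const) measurable_const)
  rw [← integral_indicator hS, ← integral_indicator measurableSet_punctured_ball,
    ← integral_add_left_eq_self _ x]
  have h := Measure.integral_comp_smul_of_nonneg (volume : Measure E2)
    (fun z => Set.indicator {y : E2 | 0 < dist y x ∧ dist y x ≤ δ}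
      (fun y => ((⟪x - y, u x - u y⟫ / dist x y ^ 3) • (x - y) : E2)) (x + z)) δ (hR := hδ.le)
  rw [finrank_euclideanSpace_fin, eq_inv_smul_iff₀ (by positivity)] at h
  rw [← h, smul_smul, ← integral_smul, ← integral_smul]
  congr 1
  ext1 w
  have hd : dist (x + δ • w) x = δ * ‖w‖ := by
    simp [dist_eq_norm, norm_smul, abs_of_pos hδ]
  by_cases hw : 0 < ‖w‖ ∧ ‖w‖ ≤ 1
  · rw [Set.indicator_of_mem (by
        rw [Set.mem_ofPred_eq, hd]
        exact ⟨mul_pos hδ hw.1, mul_le_of_le_one_right hδ.le hw.2⟩),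
      Set.indicator_of_mem (by exact hw), dist_eq_norm]
    have e : x - (x + δ • w) = -(δ • w) := by abel
    have e2 : (⟪x - (x + δ • w), u x - u (x + δ • w)⟫ / ‖x - (x + δ • w)‖ ^ 3) •
        (x - (x + δ • w)) = bondForce (δ • w) (u x - u (x + δ • w)) := by
      rw [e, bondForce, norm_neg, inner_neg_left, neg_div, neg_smul_neg]
    rw [e2, bondForce_smul_left hδ, bondForce_smul, smul_smul, smul_smul]
    congr 1
    field_simp
  · rw [Set.indicator_of_notMem (by
        rw [Set.mem_ofPred_eq, hd]
        exact fun h => hw ⟨pos_of_mul_pos_right h.1 hδ.le, by nlinarith [h.2]⟩),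
      Set.indicator_of_notMem (by exact hw)]
    simp

theorem integral_bondForce_remainder {u : E2 → E2} (hu : ContDiff ℝ 2 u) {M : ℝ}
    (hM : ∀ x, ‖iteratedFDeriv ℝ 2 u x‖ ≤ M) (x : E2) {δ : ℝ} (hδ : 0 < δ) :
    ∫ w in {w : E2 | 0 < ‖w‖ ∧ ‖w‖ ≤ 1}, bondForce w ((δ ^ 2)⁻¹ • (u x - u (x + δ • w)))
      = -∫ w in {w : E2 | 0 < ‖w‖ ∧ ‖w‖ ≤ 1},
        bondForce w ((δ ^ 2)⁻¹ • (u (x + δ • w) - u x - δ • fderiv ℝ u x w)) := by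
  have hM0 : 0 ≤ M := (norm_nonneg _).trans (hM x)
  have hmeas : Measurable
      fun w => (δ ^ 2)⁻¹ • (u (x + δ • w) - u x - δ • fderiv ℝ u x w) := by
    have := hu.continuous
    exact Continuous.measurable (by fun_prop)
  have hR : IntegrableOn (fun w => bondForce w
      ((δ ^ 2)⁻¹ • (u (x + δ • w) - u x - δ • fderiv ℝ u x w)))
      {w : E2 | 0 < ‖w‖ ∧ ‖w‖ ≤ 1} := by
    refine integrableOn_bondForce hmeas hM0 fun w hw => ?_
    have := norm_smul_taylor_remainder_le hu hM x w hδ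
    exact this.trans (by gcongr; nlinarith [norm_nonneg w])
  have hA : IntegrableOn (fun w => bondForce w (((δ⁻¹ • fderiv ℝ u x : E2 →L[ℝ] E2)) w))
      {w : E2 | 0 < ‖w‖ ∧ ‖w‖ ≤ 1} :=
    integrableOn_bondForce (ContinuousLinearMap.measurable _) (norm_nonneg _)
      fun w _ => ContinuousLinearMap.le_opNorm _ w
  have := integral_add hR hA
  rw [integral_bondForce_linear, add_zero] at this
  rw [← this, ← integral_neg]
  congr 1
  ext1 w
  rw [← bondForce_add, ← bondForce_neg]
  congr 1
  rw [smul_apply, smul_sub _ _ (δ • _), smul_smul,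
    show (δ ^ 2)⁻¹ * δ = δ⁻¹ by field_simp, smul_sub, smul_sub]
  abel

theorem tendsto_integral_bondForce_remainder {u : E2 → E2} (hu : ContDiff ℝ 2 u) {M : ℝ}
    (hM : ∀ x, ‖iteratedFDeriv ℝ 2 u x‖ ≤ M) (x : E2) :
    Tendsto (fun δ : ℝ => ∫ w in {w : E2 | 0 < ‖w‖ ∧ ‖w‖ ≤ 1},
        bondForce w ((δ ^ 2)⁻¹ • (u (x + δ • w) - u x - δ • fderiv ℝ u x w)))
      (nhdsWithin 0 (Set.Ioi 0))
      (nhds (∫ w in {w : E2 | 0 < ‖w‖ ∧ ‖w‖ ≤ 1},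
        bondForce w ((1 / 2 : ℝ) • fderiv ℝ (fderiv ℝ u) x w w))) := by
  have hM0 : 0 ≤ M := (norm_nonneg _).trans (hM x)
  refine tendsto_integral_filter_of_dominated_convergence (fun _ => M) ?_ ?_ ?_ ?_
  · refine Eventually.of_forall fun δ => (measurable_bondForce ?_).aestronglyMeasurable
    have := hu.continuous
    exact Continuous.measurable (by fun_prop)
  · filter_upwards [self_mem_nhdsWithin] with δ hδ
    refine (ae_restrict_iff' measurableSet_punctured_ball).2 (Eventually.of_forall fun w hw => ?_)
    refine norm_bondForce_le_of_le hM0 ((norm_smul_taylor_remainder_le hu hM x w hδ).trans ?_)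
    gcongr
    nlinarith [norm_nonneg w, hw.2]
  · exact integrableOn_const volume_punctured_ball_lt_top.ne
  · refine Eventually.of_forall fun w => ?_
    have hc : Continuous fun v => bondForce w v := by
      unfold bondForce
      fun_prop
    exact (hc.tendsto _).comp (tendsto_taylor_two hu x w)

theorem integrableOn_moment (a b : ℕ) (hab : a + b = 4) :
    IntegrableOn (fun w : E2 => w 0 ^ a * w 1 ^ b / ‖w‖ ^ 3)
      {w : E2 | 0 < ‖w‖ ∧ ‖w‖ ≤ 1} := by
  refine Measure.integrableOn_of_bounded (M := 1) volume_punctured_ball_lt_top.ne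
    (Measurable.aestronglyMeasurable (by fun_prop))
    ((ae_restrict_iff' measurableSet_punctured_ball).2 (Eventually.of_forall fun w hw => ?_))
  obtain ⟨h0, h1⟩ := hw
  have ha := PiLp.norm_apply_le w 0
  have hb := PiLp.norm_apply_le w 1
  rw [norm_div, norm_mul, norm_pow, norm_pow, norm_pow, norm_norm, div_le_one (by positivity)]
  calc ‖w 0‖ ^ a * ‖w 1‖ ^ b ≤ ‖w‖ ^ a * ‖w‖ ^ b := by gcongr
    _ = ‖w‖ ^ 4 := by rw [← pow_add, hab]
    _ ≤ ‖w‖ ^ 3 := pow_le_pow_of_le_one h0.le h1 (by norm_num)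

theorem integral_quartic (c₀ c₁ c₂ c₃ c₄ : ℝ) :
    ∫ w in {w : E2 | 0 < ‖w‖ ∧ ‖w‖ ≤ 1},
      (c₀ * (w 0 ^ 4 * w 1 ^ 0 / ‖w‖ ^ 3) + c₁ * (w 0 ^ 3 * w 1 ^ 1 / ‖w‖ ^ 3)
        + c₂ * (w 0 ^ 2 * w 1 ^ 2 / ‖w‖ ^ 3) + c₃ * (w 0 ^ 1 * w 1 ^ 3 / ‖w‖ ^ 3)
        + c₄ * (w 0 ^ 0 * w 1 ^ 4 / ‖w‖ ^ 3))
      = Real.pi / 4 * c₀ + Real.pi / 12 * c₂ + Real.pi / 4 * c₄ := by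
  have i0 := (integrableOn_moment 4 0 rfl).const_mul c₀
  have i1 := (integrableOn_moment 3 1 rfl).const_mul c₁
  have i2 := (integrableOn_moment 2 2 rfl).const_mul c₂
  have i3 := (integrableOn_moment 1 3 rfl).const_mul c₃
  have i4 := (integrableOn_moment 0 4 rfl).const_mul c₄
  rw [integral_add (((i0.fun_add i1).fun_add i2).fun_add i3) i4,
    integral_add ((i0.fun_add i1).fun_add i2) i3, integral_add (i0.fun_add i1) i2, integral_add i0 i1]
  simp only [integral_const_mul]
  rw [integral_punctured_ball_moment 4 0 rfl, integral_punctured_ball_moment 3 1 rfl,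
    integral_punctured_ball_moment 2 2 rfl, integral_punctured_ball_moment 1 3 rfl,
    integral_punctured_ball_moment 0 4 rfl, integral_cos_four, integral_cos_three_sin,
    integral_cos_two_sin_two, integral_cos_sin_three, integral_sin_four]
  ring

theorem integral_bondForce_bilinear_apply (B : E2 →L[ℝ] E2 →L[ℝ] E2)
    (hB : ∀ v w, B v w = B w v) (i : Fin 2) :
    (∫ w in {w : E2 | 0 < ‖w‖ ∧ ‖w‖ ≤ 1}, bondForce w (B w w)) i
      = Real.pi / 12 * ∑ j : Fin 2,
        (B (EuclideanSpace.single j 1) (EuclideanSpace.single j 1) i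
          + 2 * B (EuclideanSpace.single i 1) (EuclideanSpace.single j 1) j) := by
  have hint : IntegrableOn (fun w => bondForce w (B w w)) {w : E2 | 0 < ‖w‖ ∧ ‖w‖ ≤ 1} := by
    refine integrableOn_bondForce (Continuous.measurable (by fun_prop)) (norm_nonneg B)
      fun w hw => ?_
    refine (B.le_opNorm₂ w w).trans ?_
    exact mul_le_of_le_one_right (by positivity) hw
  have hproj := (EuclideanSpace.proj (𝕜 := ℝ) i : E2 →L[ℝ] ℝ).integral_comp_comm hint
  simp only [PiLp.proj_apply] at hproj
  rw [← hproj]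
  have hsplit : ∀ w : E2, w = w 0 • EuclideanSpace.single 0 (1 : ℝ)
      + w 1 • EuclideanSpace.single 1 (1 : ℝ) := by
    intro w
    ext k
    fin_cases k <;> simp
  set e₀ : E2 := EuclideanSpace.single 0 (1 : ℝ) with he₀
  set e₁ : E2 := EuclideanSpace.single 1 (1 : ℝ) with he₁
  have hBw : ∀ (w : E2) (j : Fin 2), B w w j
      = w 0 ^ 2 * B e₀ e₀ j + 2 * (w 0 * w 1) * B e₀ e₁ j + w 1 ^ 2 * B e₁ e₁ j := by
    intro w j
    conv_lhs => rw [hsplit w]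
    simp only [map_add, map_smul, add_apply, smul_apply, hB e₁ e₀, PiLp.add_apply,
      PiLp.smul_apply, smul_eq_mul]
    ring
  have hf : ∀ w : E2, bondForce w (B w w) i
      = (w 0 * B w w 0 + w 1 * B w w 1) * w i / ‖w‖ ^ 3 := by
    intro w
    simp only [bondForce, PiLp.smul_apply, smul_eq_mul, PiLp.inner_apply, Fin.sum_univ_two,
      RCLike.inner_apply, conj_trivial]
    ring
  obtain rfl | rfl : i = 0 ∨ i = 1 := by omega
  · have := integral_quartic (B e₀ e₀ 0) (2 * B e₀ e₁ 0 + B e₀ e₀ 1)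
      (B e₁ e₁ 0 + 2 * B e₀ e₁ 1) (B e₁ e₁ 1) 0
    simp only [Fin.sum_univ_two]
    refine Eq.trans (integral_congr_ae (Eventually.of_forall fun w => ?_)) (this.trans ?_)
    · beta_reduce
      rw [hf, hBw w 0, hBw w 1]
      ring
    · simp only [← he₀, ← he₁]
      ring
  · have := integral_quartic 0 (B e₀ e₀ 0) (2 * B e₀ e₁ 0 + B e₀ e₀ 1)
      (B e₁ e₁ 0 + 2 * B e₀ e₁ 1) (B e₁ e₁ 1)
    simp only [Fin.sum_univ_two]
    refine Eq.trans (integral_congr_ae (Eventually.of_forall fun w => ?_)) (this.trans ?_)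
    · beta_reduce
      rw [hf, hBw w 0, hBw w 1]
      ring
    · rw [← he₀, ← he₁, hB e₁ e₀]
      ring

theorem vecLaplacian_eq {u : E2 → E2} {x : E2} (h : DifferentiableAt ℝ (fderiv ℝ u) x) :
    vecLaplacian u x = ∑ j : Fin 2, fderiv ℝ (fderiv ℝ u) x (EuclideanSpace.single j 1)
      (EuclideanSpace.single j 1) := by
  refine Finset.sum_congr rfl fun j _ => ?_
  rw [fderiv_clm_apply h (differentiableAt_const _)]
  simp

theorem gradDiv_apply {u : E2 → E2} {x : E2} (h : DifferentiableAt ℝ (fderiv ℝ u) x)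
    (i : Fin 2) :
    gradDiv u x i = ∑ j : Fin 2, fderiv ℝ (fderiv ℝ u) x (EuclideanSpace.single i 1)
      (EuclideanSpace.single j 1) j := by
  have hd : HasFDerivAt (diverg u) (∑ j : Fin 2,
      (EuclideanSpace.proj (𝕜 := ℝ) j : E2 →L[ℝ] ℝ).comp
        ((fderiv ℝ (fderiv ℝ u) x).flip (EuclideanSpace.single j 1))) x := by
    refine HasFDerivAt.fun_sum fun j _ => ?_
    refine (EuclideanSpace.proj (𝕜 := ℝ) j : E2 →L[ℝ] ℝ).hasFDerivAt.comp x ?_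
    convert h.hasFDerivAt.clm_apply (hasFDerivAt_const (EuclideanSpace.single j (1 : ℝ)) x) using 1
    ext
    simp
  change fderiv ℝ (diverg u) x (EuclideanSpace.single i 1) = _
  rw [hd.fderiv]
  simp

/-- for `u ∈ C²` with bounded second derivatives, the scaled linear
bond-based peridynamic operator converges pointwise to the local Navier operator
`-P₀u = -(π/4)Δu - (π/2)∇ div u` as the horizon `δ → 0⁺`.  The matrix kernel acts as
`((x-y)(x-y)ᵀ/|x-y|³)(u(x)-u(y)) = (⟪x-y, u(x)-u(y)⟫/|x-y|³) • (x-y)`. -/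
theorem peridynamic_local_limit
    (u : E2 → E2) (hu : ContDiff ℝ 2 u)
    (hbd : ∃ M, ∀ x, ‖iteratedFDeriv ℝ 2 u x‖ ≤ M)
    (x : E2) :
    Tendsto (fun δ : ℝ =>
        (6 / δ ^ 3) • ∫ y in {y : E2 | 0 < dist y x ∧ dist y x ≤ δ},
          ((⟪x - y, u x - u y⟫ / dist x y ^ 3) • (x - y) : E2))
      (nhdsWithin 0 (Set.Ioi 0))
      (nhds (-((Real.pi / 4) • vecLaplacian u x) - (Real.pi / 2) • gradDiv u x)) := by
  obtain ⟨M, hM⟩ := hbd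
  have hdu : DifferentiableAt ℝ (fderiv ℝ u) x :=
    (hu.fderiv_right (m := 1) (by norm_num)).differentiable (by norm_num) x
  have hsymm : ∀ v w, fderiv ℝ (fderiv ℝ u) x v w = fderiv ℝ (fderiv ℝ u) x w v :=
    fun v w => hu.contDiffAt.isSymmSndFDerivAt (by simp) v w
  have hlim := (tendsto_integral_bondForce_remainder hu hM x).neg.const_smul (6 : ℝ)
  have hval : (6 : ℝ) • -(∫ w in {w : E2 | 0 < ‖w‖ ∧ ‖w‖ ≤ 1},
        bondForce w ((1 / 2 : ℝ) • fderiv ℝ (fderiv ℝ u) x w w))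
      = -((Real.pi / 4) • vecLaplacian u x) - (Real.pi / 2) • gradDiv u x := by
    simp only [bondForce_smul, integral_smul]
    ext i
    simp only [PiLp.smul_apply, PiLp.neg_apply, PiLp.sub_apply, smul_eq_mul,
      integral_bondForce_bilinear_apply _ hsymm, gradDiv_apply hdu, vecLaplacian_eq hdu,
      Fin.sum_univ_two, PiLp.add_apply]
    ring
  rw [hval] at hlim
  refine hlim.congr' ?_
  filter_upwards [self_mem_nhdsWithin] with δ hδ
  rw [peridynamic_rescale u x hδ, integral_bondForce_remainder hu hM x hδ]
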